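/- In the smooth solution setting for the approximated TV Wasserstein gradient flow on the torus (with parameters T > 0, ε ≥ 0, c ≥ 0), let H : (c, ∞) → ℝ be a C² convex function. Then the function t ↦ ∫ H(ρ(t, x)) dx (integral over [0,1)ᵈ) is nonincreasing on [0, T]. -/

import Mathlib

open MeasureTheory
open scoped RealInnerProductSpace

noncomputable section

/-- The fundamental domain `[0,1)^d` of the torus, inside `ℝ^d`. -/
def UnitCube (d : ℕ) : Set (EuclideanSpace ℝ (Fin d)) :=
  {x | ∀ i, 0 ≤ x i ∧ x i < 1}

/-- A function on `ℝ^d` is `ℤ^d`-periodic if it is invariant under translations by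
integer vectors. -/
def ZdPeriodic {d : ℕ} {V : Type*} (f : EuclideanSpace ℝ (Fin d) → V) : Prop :=
  ∀ (x : EuclideanSpace ℝ (Fin d)) (m : Fin d → ℤ),
    f (x + (EuclideanSpace.equiv (Fin d) ℝ).symm (fun i => (m i : ℝ))) = f x

/-- The divergence of a vector field on `ℝ^d`. -/
noncomputable def diverg {d : ℕ}
    (z : EuclideanSpace ℝ (Fin d) → EuclideanSpace ℝ (Fin d))
    (x : EuclideanSpace ℝ (Fin d)) : ℝ :=
  ∑ i, fderiv ℝ z x (EuclideanSpace.single i 1) i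


open scoped ContDiff

/-- partial derivative -/
def pd {d : ℕ} (i : Fin d) (f : EuclideanSpace ℝ (Fin d) → ℝ) (x : EuclideanSpace ℝ (Fin d)) : ℝ :=
  fderiv ℝ f x (EuclideanSpace.single i 1)

def KCube (d : ℕ) : Set (EuclideanSpace ℝ (Fin d)) :=
  (WithLp.toLp 2) '' (Set.Icc (0 : Fin d → ℝ) 1)

lemma isCompact_KCube (d : ℕ) : IsCompact (KCube d) :=
  isCompact_Icc.image (PiLp.continuous_toLp 2 _)

lemma cube_subset (d : ℕ) : UnitCube d ⊆ KCube d := by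
  intro x hx
  exact ⟨WithLp.ofLp x, ⟨fun i => (hx i).1, fun i => (hx i).2.le⟩, rfl⟩

lemma measurableSet_cube (d : ℕ) : MeasurableSet (UnitCube d) := by
  have : UnitCube d = ⋂ i, {x | 0 ≤ x i ∧ x i < 1} := by
    ext x; simp [UnitCube]
  rw [this]
  refine MeasurableSet.iInter fun i => ?_
  have hm : Measurable fun x : EuclideanSpace ℝ (Fin d) => x i := by fun_prop
  exact (measurableSet_le measurable_const hm).inter (measurableSet_lt hm measurable_const)

lemma intOn_cube {d : ℕ} {f : EuclideanSpace ℝ (Fin d) → ℝ} (hf : Continuous f) :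
    Integrable f (volume.restrict (UnitCube d)) :=
  (hf.continuousOn.integrableOn_compact (isCompact_KCube d)).mono_set (cube_subset d)

lemma vol_cube_ne_top (d : ℕ) : volume (UnitCube d) ≠ ⊤ :=
  ((measure_mono (cube_subset d)).trans_lt (isCompact_KCube d).measure_lt_top).ne

lemma integral_cube {d : ℕ} (f : EuclideanSpace ℝ (Fin d) → ℝ) :
    ∫ x in UnitCube d, f x = ∫ y in Set.Icc (0 : Fin d → ℝ) 1, f (WithLp.toLp 2 y) := by
  rw [← (PiLp.volume_preserving_toLp (Fin d)).setIntegral_preimage_emb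
    (MeasurableEquiv.toLp 2 (Fin d → ℝ)).measurableEmbedding]
  apply setIntegral_congr_set
  have : (WithLp.toLp 2 : (Fin d → ℝ) → EuclideanSpace ℝ (Fin d)) ⁻¹' UnitCube d
      = Set.univ.pi fun i => Set.Ico ((0 : Fin d → ℝ) i) ((1 : Fin d → ℝ) i) := by
    ext x; simp [UnitCube]
  rw [this]
  exact Measure.univ_pi_Ico_ae_eq_Icc

lemma continuous_pd {d : ℕ} (i : Fin d) {f : EuclideanSpace ℝ (Fin d) → ℝ} (hf : ContDiff ℝ 1 f) :
    Continuous (pd i f) :=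
  (hf.continuous_fderiv (by simp)).clm_apply continuous_const

lemma contDiff_pd {d : ℕ} (i : Fin d) {f : EuclideanSpace ℝ (Fin d) → ℝ} (hf : ContDiff ℝ ∞ f) :
    ContDiff ℝ ∞ (pd i f) :=
  (hf.fderiv_right (m := ∞) (by simp)).clm_apply contDiff_const

lemma per_pd {d : ℕ} (i : Fin d) {f : EuclideanSpace ℝ (Fin d) → ℝ} (hf : ZdPeriodic f) :
    ZdPeriodic (pd i f) := by
  intro x m
  unfold pd
  rw [← fderiv_comp_add_right]
  congr 2
  funext y
  exact hf y m

lemma pd_comm {d : ℕ} (i j : Fin d) {f : EuclideanSpace ℝ (Fin d) → ℝ} (hf : ContDiff ℝ ∞ f) :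
    pd i (pd j f) = pd j (pd i f) := by
  have h2 : ContDiff ℝ ∞ (fderiv ℝ f) := hf.fderiv_right (m := ∞) (by simp)
  have hd : Differentiable ℝ (fderiv ℝ f) := h2.differentiable (by simp)
  have key : ∀ a b : Fin d, ∀ x, pd a (pd b f) x =
      fderiv ℝ (fderiv ℝ f) x (EuclideanSpace.single a 1) (EuclideanSpace.single b 1) := by
    intro a b x
    unfold pd
    rw [fderiv_clm_apply (hd x) (differentiableAt_const _)]
    simp
  funext x
  rw [key, key]
  exact (hf.contDiffAt.isSymmSndFDerivAt (by simpa using ENat.LEInfty.out)) _ _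

lemma integral_pd {d : ℕ} (i : Fin d) {f : EuclideanSpace ℝ (Fin d) → ℝ} (hf : ContDiff ℝ 1 f)
    (hp : ZdPeriodic f) : ∫ x in UnitCube d, pd i f x = 0 := by
  obtain ⟨n, rfl⟩ : ∃ n, d = n + 1 := ⟨d - 1, by have := i.2; omega⟩
  rw [integral_cube]
  set L : (Fin (n+1) → ℝ) →L[ℝ] EuclideanSpace ℝ (Fin (n+1)) :=
    (EuclideanSpace.equiv (Fin (n+1)) ℝ).symm.toContinuousLinearMap with hL
  have hLa : ∀ y, L y = WithLp.toLp 2 y := fun y => rfl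
  have hdf : Differentiable ℝ f := hf.differentiable (by simp)
  have hsum : ∀ y : Fin (n+1) → ℝ, ∑ j, (if j = i then (fderiv ℝ f (L y)).comp L else 0)
      (Pi.single j 1) = pd i f (WithLp.toLp 2 y) := by
    intro y
    rw [Finset.sum_eq_single i]
    · simp [pd, hLa]
    · intro b _ hb; simp [hb]
    · simp
  have hcont : Continuous fun y : Fin (n+1) → ℝ => pd i f (WithLp.toLp 2 y) :=
    (continuous_pd i hf).comp (PiLp.continuous_toLp 2 _)
  have := integral_divergence_of_hasFDerivAt_off_countable' (E := ℝ) (0 : Fin (n+1) → ℝ) 1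
    (fun i => by simp)
    (fun j y => if j = i then f (L y) else 0)
    (fun j y => if j = i then (fderiv ℝ f (L y)).comp L else 0) ∅ Set.countable_empty
    (fun j => by
      by_cases h : j = i
      · simp only [h, if_true]; exact (hf.continuous.comp L.continuous).continuousOn
      · simp only [h, if_false]; exact continuousOn_const)
    (fun x _ j => by
      by_cases h : j = i
      · simp only [h, if_true]; exact (hdf (L x)).hasFDerivAt.comp x L.hasFDerivAt
      · simp only [h, if_false]; exact hasFDerivAt_const _ _)
    (by
      simp only [hsum]
      exact hcont.continuousOn.integrableOn_compact isCompact_Icc)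
  simp only [hsum] at this
  rw [this]
  apply Finset.sum_eq_zero
  intro j _
  rw [sub_eq_zero]
  by_cases h : j = i
  · subst h
    simp only [if_true]
    congr 1
    funext y
    rw [← hp (L (j.insertNth ((0 : Fin (n+1) → ℝ) j) y)) (Pi.single j 1)]
    congr 1
    have : (EuclideanSpace.equiv (Fin (n+1)) ℝ).symm (fun k => (((Pi.single j 1 : Fin (n+1) → ℤ) k : ℤ) : ℝ)) =
      L (fun k => (((Pi.single j 1 : Fin (n+1) → ℤ) k : ℤ) : ℝ)) := rfl
    rw [this, ← map_add]
    congr 1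
    funext k
    refine Fin.succAboveCases j ?_ (fun k => ?_) k
    · simp
    · simp
  · simp [h]

lemma pd_mul {d : ℕ} (i : Fin d) {f g : EuclideanSpace ℝ (Fin d) → ℝ} (hf : ContDiff ℝ 1 f)
    (hg : ContDiff ℝ 1 g) (x) : pd i (fun x => f x * g x) x = f x * pd i g x + pd i f x * g x := by
  unfold pd
  rw [fderiv_fun_mul (hf.differentiable (by simp) x) (hg.differentiable (by simp) x)]
  simp; ring

lemma ibp {d : ℕ} (i : Fin d) {f g : EuclideanSpace ℝ (Fin d) → ℝ} (hf : ContDiff ℝ 1 f)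
    (hg : ContDiff ℝ 1 g) (hfp : ZdPeriodic f) (hgp : ZdPeriodic g) :
    ∫ x in UnitCube d, f x * pd i g x = - ∫ x in UnitCube d, pd i f x * g x := by
  have h := integral_pd i (hf.mul hg) (fun x m => by simp only [hfp x m, hgp x m])
  simp only [pd_mul i hf hg] at h
  have i1 : Integrable (fun x => f x * pd i g x) (volume.restrict (UnitCube d)) :=
    intOn_cube (hf.continuous.mul (continuous_pd i hg))
  have i2 : Integrable (fun x => pd i f x * g x) (volume.restrict (UnitCube d)) :=
    intOn_cube ((continuous_pd i hf).mul hg.continuous)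
  rw [integral_add i1 i2] at h
  linarith

lemma pd_sum {d : ℕ} (i : Fin d) {f : Fin d → EuclideanSpace ℝ (Fin d) → ℝ}
    (hf : ∀ j, ContDiff ℝ ∞ (f j)) (x) : pd i (fun x => ∑ j, f j x) x = ∑ j, pd i (f j) x := by
  unfold pd
  rw [fderiv_fun_sum (fun j _ => ((hf j).differentiable (by simp) x))]
  simp

lemma gradient_apply {d : ℕ} (i : Fin d) (f : EuclideanSpace ℝ (Fin d) → ℝ) (x) :
    gradient f x i = pd i f x := by
  unfold pd
  rw [← inner_gradient_left, EuclideanSpace.inner_single_right]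
  simp

lemma diverg_eq {d : ℕ} {Z : EuclideanSpace ℝ (Fin d) → EuclideanSpace ℝ (Fin d)}
    (hZ : Differentiable ℝ Z) (x) : diverg Z x = ∑ i, pd i (fun y => Z y i) x := by
  unfold diverg pd
  refine Finset.sum_congr rfl fun i _ => ?_
  have h := ((EuclideanSpace.proj i : EuclideanSpace ℝ (Fin d) →L[ℝ] ℝ).hasFDerivAt.comp x
    (hZ x).hasFDerivAt).fderiv
  have e : (fun y => Z y i) = (EuclideanSpace.proj i : EuclideanSpace ℝ (Fin d) →L[ℝ] ℝ) ∘ Z := rfl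
  rw [e, h]
  simp

lemma pd_comp {d : ℕ} (i : Fin d) {r : EuclideanSpace ℝ (Fin d) → ℝ} {φ : ℝ → ℝ} {x}
    (hr : DifferentiableAt ℝ r x) (hφ : DifferentiableAt ℝ φ (r x)) :
    pd i (fun y => φ (r y)) x = deriv φ (r x) * pd i r x := by
  unfold pd
  have h := (hφ.hasDerivAt.comp_hasFDerivAt x hr.hasFDerivAt).fderiv
  have e : (fun y => φ (r y)) = φ ∘ r := rfl
  rw [e, h]
  simp

lemma second_deriv_max {φ φ' : ℝ → ℝ} {b : ℝ} (h1 : ∀ s, HasDerivAt φ (φ' s) s)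
    (h2 : HasDerivAt φ' b 0) (hmax : ∀ s, φ s ≤ φ 0) : b ≤ 0 := by
  by_contra! hb
  have e1 : deriv φ = φ' := funext fun s => (h1 s).deriv
  have hm : IsLocalMax φ 0 := Filter.Eventually.of_forall hmax
  have hmin : IsLocalMin φ 0 := by
    apply isLocalMin_of_deriv_deriv_pos
    · rw [e1, h2.deriv]; exact hb
    · exact hm.deriv_eq_zero
    · exact (h1 0).continuousAt
  have hc : φ =ᶠ[nhds 0] fun _ => φ 0 := by
    filter_upwards [hmin] with s hs
    exact le_antisymm (hmax s) hs
  have := hc.deriv.deriv_eq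
  rw [e1, h2.deriv] at this
  simp at this
  exact hb.ne' this

lemma pointwise_lap {d : ℕ} (i : Fin d)
    {r : EuclideanSpace ℝ (Fin d) → ℝ} {Z : EuclideanSpace ℝ (Fin d) → EuclideanSpace ℝ (Fin d)}
    (hZ : ∀ j, ContDiff ℝ ∞ (fun y => Z y j)) (hZ1 : ∀ x, ‖Z x‖ ≤ 1) {x}
    (hx : ‖gradient r x‖ = ⟪Z x, gradient r x⟫) :
    ∑ j, pd j r x * pd i (pd i (fun y => Z y j)) x ≤ 0 := by
  have hline : ∀ s : ℝ, HasDerivAt (fun s : ℝ => x + s • (EuclideanSpace.single i (1:ℝ)))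
      (EuclideanSpace.single i (1:ℝ)) s := by
    intro s
    simpa using ((hasDerivAt_id s).smul_const (EuclideanSpace.single i (1:ℝ))).const_add x
  have hcomp : ∀ (f : EuclideanSpace ℝ (Fin d) → ℝ), ContDiff ℝ ∞ f → ∀ s : ℝ,
      HasDerivAt (fun s : ℝ => f (x + s • (EuclideanSpace.single i (1:ℝ))))
        (pd i f (x + s • (EuclideanSpace.single i (1:ℝ)))) s := by
    intro f hf s
    exact (hf.differentiable (by simp) _).hasFDerivAt.comp_hasDerivAt s (hline s)
  have hin : ∀ y, ⟪Z y, gradient r x⟫ = ∑ j, pd j r x * Z y j := by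
    intro y
    rw [PiLp.inner_apply]
    refine Finset.sum_congr rfl fun j _ => ?_
    rw [gradient_apply]
    simp
  refine second_deriv_max
    (φ := fun s => ∑ j, pd j r x * Z (x + s • (EuclideanSpace.single i (1:ℝ))) j)
    (φ' := fun s => ∑ j, pd j r x *
      pd i (fun y => Z y j) (x + s • (EuclideanSpace.single i (1:ℝ)))) ?_ ?_ ?_
  · intro s
    exact HasDerivAt.fun_sum fun j _ => (hcomp _ (hZ j) s).const_mul _
  · have := HasDerivAt.fun_sum (u := Finset.univ) fun j _ =>
      (hcomp _ (contDiff_pd i (hZ j)) 0).const_mul (pd j r x)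
    simpa using this
  · intro s
    rw [← hin]
    simp only [zero_smul, add_zero]
    rw [← hin, ← hx]
    calc _ ≤ ‖Z (x + s • (EuclideanSpace.single i (1:ℝ)))‖ * ‖gradient r x‖ :=
          real_inner_le_norm _ _
      _ ≤ 1 * ‖gradient r x‖ := by gcongr; exact hZ1 _
      _ = _ := one_mul _

lemma swap_int {d : ℕ} (i j : Fin d) {g f : EuclideanSpace ℝ (Fin d) → ℝ}
    (hg : ContDiff ℝ 1 g) (hgp : ZdPeriodic g) (hf : ContDiff ℝ ∞ f) (hfp : ZdPeriodic f) :
    ∫ x in UnitCube d, pd i g x * pd i (pd j f) x =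
      ∫ x in UnitCube d, pd j g x * pd i (pd i f) x := by
  have h1 := ibp i hg ((contDiff_pd i (contDiff_pd j hf)).of_le (by simp)) hgp
    (per_pd i (per_pd j hfp))
  have h2 := ibp j hg ((contDiff_pd i (contDiff_pd i hf)).of_le (by simp)) hgp
    (per_pd i (per_pd i hfp))
  have e : pd i (pd i (pd j f)) = pd j (pd i (pd i f)) := by
    rw [pd_comm i j hf, pd_comm i j (contDiff_pd i hf)]
  rw [e] at h1
  linarith

lemma slice {d : ℕ} {ε c : ℝ} (hε : 0 ≤ ε) (hc : 0 ≤ c)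
    {r : EuclideanSpace ℝ (Fin d) → ℝ} {Z : EuclideanSpace ℝ (Fin d) → EuclideanSpace ℝ (Fin d)}
    (hr : ContDiff ℝ ∞ r) (hZs : ContDiff ℝ ∞ Z) (hrp : ZdPeriodic r) (hZp : ZdPeriodic Z)
    (hrc : ∀ x, c < r x) (hZ1 : ∀ x, ‖Z x‖ ≤ 1)
    (hcomp : ∫ x in UnitCube d, ‖gradient r x‖ ≤ ∫ x in UnitCube d, ⟪Z x, gradient r x⟫)
    {H : ℝ → ℝ} (hH : ContDiffOn ℝ 2 H (Set.Ioi c)) (hHconv : ConvexOn ℝ (Set.Ioi c) H) :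
    0 ≤ ∫ x in UnitCube d, deriv H (r x) * diverg (fun y => r y •
          gradient (fun w => diverg Z w + ε / (r w - c) ^ 2) y) x := by
  have hr1 : ContDiff ℝ 1 r := hr.of_le (by simp)
  have hrd : Differentiable ℝ r := hr.differentiable (by simp)
  have hZ : ∀ j, ContDiff ℝ ∞ (fun y => Z y j) := fun j => by fun_prop
  have hZjp : ∀ j, ZdPeriodic (fun y => Z y j) := fun j x m => by simp only [hZp x m]
  have hne : ∀ x, r x - c ≠ 0 := fun x => (sub_pos.2 (hrc x)).ne'
  -- compatibility a.e.
  have hgrad : Continuous (gradient r) := by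
    have : gradient r = fun x => (InnerProductSpace.toDual ℝ _).symm (fderiv ℝ r x) := rfl
    rw [this]
    exact (LinearIsometryEquiv.continuous _).comp (hr1.continuous_fderiv (by simp))
  have hae : ∀ᵐ x ∂(volume.restrict (UnitCube d)), ‖gradient r x‖ = ⟪Z x, gradient r x⟫ := by
    have c1 : Continuous fun x => ‖gradient r x‖ := hgrad.norm
    have c2 : Continuous fun x => ⟪Z x, gradient r x⟫ := hZs.continuous.inner hgrad
    have hle : ∀ x, ⟪Z x, gradient r x⟫ ≤ ‖gradient r x‖ := fun x =>
      (real_inner_le_norm _ _).trans (mul_le_of_le_one_left (norm_nonneg _) (hZ1 x))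
    have hn : 0 ≤ᵐ[volume.restrict (UnitCube d)]
        fun x => ‖gradient r x‖ - ⟪Z x, gradient r x⟫ :=
      Filter.Eventually.of_forall fun x => sub_nonneg.2 (hle x)
    have h0 : ∫ x in UnitCube d, (‖gradient r x‖ - ⟪Z x, gradient r x⟫) = 0 := by
      apply le_antisymm
      · rw [integral_sub (intOn_cube c1) (intOn_cube c2)]; linarith
      · exact integral_nonneg_of_ae hn
    have := (integral_eq_zero_iff_of_nonneg_ae hn (intOn_cube (c1.sub c2))).1 h0
    filter_upwards [this] with x hx
    exact sub_eq_zero.1 hx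
  -- H
  have hH1 : ContDiffOn ℝ 1 (deriv H) (Set.Ioi c) :=
    hH.deriv_of_isOpen isOpen_Ioi (by norm_num)
  have hHd : ∀ s ∈ Set.Ioi c, DifferentiableAt ℝ H s := fun s hs =>
    (hH.differentiableOn (by simp) s hs).differentiableAt (isOpen_Ioi.mem_nhds hs)
  have hH1d : ∀ s ∈ Set.Ioi c, DifferentiableAt ℝ (deriv H) s := fun s hs =>
    (hH1.differentiableOn (by simp) s hs).differentiableAt (isOpen_Ioi.mem_nhds hs)
  have hH2 : ∀ s ∈ Set.Ioi c, 0 ≤ deriv (deriv H) s := by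
    intro s hs
    have hm := hHconv.monotoneOn_deriv hHd
    have := hm.derivWithin_nonneg (x := s)
    rwa [derivWithin_of_isOpen isOpen_Ioi hs] at this
  set h1 : EuclideanSpace ℝ (Fin d) → ℝ := fun x => deriv H (r x) with hh1
  have h1s : ContDiff ℝ 1 h1 := hH1.comp_contDiff hr1 hrc
  have h1p : ZdPeriodic h1 := fun x m => by simp only [hh1, hrp x m]
  have hHr : ContDiff ℝ 1 (fun x => H (r x)) := (hH.of_le (by norm_num)).comp_contDiff hr1 hrc
  set g : EuclideanSpace ℝ (Fin d) → ℝ := fun x => r x * h1 x - H (r x) with hg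
  have gs : ContDiff ℝ 1 g := (hr1.mul h1s).sub hHr
  have gp : ZdPeriodic g := fun x m => by simp only [hg, hh1, hrp x m]
  have pd_h1 : ∀ i x, pd i h1 x = deriv (deriv H) (r x) * pd i r x := fun i x =>
    pd_comp i (hrd x) (hH1d _ (hrc x))
  have pd_g : ∀ i x, pd i g x = r x * deriv (deriv H) (r x) * pd i r x := by
    intro i x
    have e : pd i g x = pd i (fun x => r x * h1 x) x - pd i (fun x => H (r x)) x := by
      unfold pd
      rw [hg, fderiv_fun_sub ((hr1.mul h1s).differentiable (by simp) x)
        (hHr.differentiable (by simp) x)]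
      simp
    rw [e, pd_mul i hr1 h1s, pd_comp i (hrd x) (hHd _ (hrc x)), pd_h1]
    simp only [hh1]; ring
  -- D, q, u
  set D : EuclideanSpace ℝ (Fin d) → ℝ := fun x => ∑ j, pd j (fun y => Z y j) x with hD
  have Ds : ContDiff ℝ ∞ D := ContDiff.sum fun j _ => contDiff_pd j (hZ j)
  have Dp : ZdPeriodic D := fun x m => by
    simp only [hD]
    exact Finset.sum_congr rfl fun j _ => per_pd j (hZjp j) x m
  set q : EuclideanSpace ℝ (Fin d) → ℝ := fun w => ε / (r w - c) ^ 2 with hq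
  have qs : ContDiff ℝ ∞ q :=
    contDiff_const.div ((hr.sub contDiff_const).pow 2) fun x => pow_ne_zero _ (hne x)
  have qp : ZdPeriodic q := fun x m => by simp only [hq, hrp x m]
  have pd_q : ∀ i x, pd i q x = -(2 * ε / (r x - c) ^ 3) * pd i r x := by
    intro i x
    have hd : HasDerivAt (fun s => ε / (s - c) ^ 2) (-(2 * ε / (r x - c) ^ 3)) (r x) := by
      have := (((hasDerivAt_id (r x)).sub_const c).pow 2).fun_inv (pow_ne_zero 2 (hne x))
      refine (this.const_mul ε).congr_deriv ?_
      have := hne x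
      simp
      field_simp
    rw [← hd.deriv]
    exact pd_comp (φ := fun s => ε / (s - c) ^ 2) i (hrd x) hd.differentiableAt
  set u : EuclideanSpace ℝ (Fin d) → ℝ := fun w => D w + q w with hu
  have us : ContDiff ℝ ∞ u := Ds.add qs
  have up : ZdPeriodic u := fun x m => by simp only [hu, Dp x m, qp x m]
  have hueq : (fun w => diverg Z w + ε / (r w - c) ^ 2) = u := by
    funext w
    simp only [hu, hD, hq, diverg_eq (hZs.differentiable (by simp))]
  have pd_u : ∀ i x, pd i u x = (∑ j, pd i (pd j (fun y => Z y j)) x) + pd i q x := by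
    intro i x
    rw [← pd_sum i (fun j => contDiff_pd j (hZ j))]
    change pd i u x = pd i D x + pd i q x
    unfold pd
    rw [hu, fderiv_fun_add (Ds.differentiable (by simp) x) (qs.differentiable (by simp) x)]
    simp
  have hgu : Differentiable ℝ (gradient u) := by
    have : gradient u = fun x => (InnerProductSpace.toDual ℝ _).symm (fderiv ℝ u x) := rfl
    rw [this]
    exact (LinearIsometryEquiv.differentiable _).comp
      ((us.fderiv_right (m := ∞) (by simp)).differentiable (by simp))
  have hdiv : ∀ x, diverg (fun y => r y • gradient u y) x =
      ∑ i, pd i (fun y => r y * pd i u y) x := by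
    intro x
    rw [diverg_eq (hrd.fun_smul hgu)]
    refine Finset.sum_congr rfl fun i _ => ?_
    congr 1
    funext y
    simp [gradient_apply]
  rw [hueq]
  simp only [hdiv, Finset.mul_sum]
  have rus : ∀ i, ContDiff ℝ 1 (fun y => r y * pd i u y) := fun i =>
    hr1.mul ((contDiff_pd i us).of_le (by simp))
  have rup : ∀ i, ZdPeriodic (fun y => r y * pd i u y) := fun i x m => by
    simp only [hrp x m, per_pd i up x m]
  have crus : ∀ i, Continuous (pd i (fun y => r y * pd i u y)) := fun i => continuous_pd i (rus i)
  have ch1 : Continuous h1 := h1s.continuous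
  change 0 ≤ ∫ x in UnitCube d, ∑ i, h1 x * pd i (fun y => r y * pd i u y) x
  rw [integral_finsetSum _ fun i _ => intOn_cube (by fun_prop)]
  refine Finset.sum_nonneg fun i _ => ?_
  rw [ibp i h1s (rus i) h1p (rup i), neg_nonneg]
  have cg : ∀ j, Continuous (pd j g) := fun j => continuous_pd j gs
  have cZ : ∀ i j k, Continuous (pd i (pd j (fun y => Z y k))) := fun i j k =>
    (contDiff_pd i (contDiff_pd j (hZ k))).continuous
  have cq : ∀ j, Continuous (pd j q) := fun j => (contDiff_pd j qs).continuous
  have e1 : ∀ x, pd i h1 x * (r x * pd i u x) =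
      (∑ j, pd i g x * pd i (pd j (fun y => Z y j)) x) + pd i g x * pd i q x := by
    intro x
    rw [← Finset.mul_sum, ← mul_add, ← pd_u, pd_g, pd_h1]; ring
  simp only [e1]
  rw [integral_add (intOn_cube (by fun_prop)) (intOn_cube (by fun_prop)),
    integral_finsetSum _ fun j _ => intOn_cube (by fun_prop)]
  simp only [fun j => swap_int i j gs gp (hZ j) (hZjp j)]
  rw [← integral_finsetSum _ fun j _ => intOn_cube (by fun_prop),
    ← integral_add (intOn_cube (by fun_prop)) (intOn_cube (by fun_prop))]
  apply integral_nonpos_of_ae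
  filter_upwards [hae] with x hx
  have hl := pointwise_lap i hZ hZ1 hx
  have hw : 0 ≤ r x * deriv (deriv H) (r x) :=
    mul_nonneg (hc.trans (hrc x).le) (hH2 _ (hrc x))
  have a1 : ∑ j, pd j g x * pd i (pd i (fun y => Z y j)) x ≤ 0 := by
    simp only [pd_g, mul_assoc (r x * deriv (deriv H) (r x))]
    rw [← Finset.mul_sum]
    exact mul_nonpos_of_nonneg_of_nonpos hw hl
  have a2 : pd i g x * pd i q x ≤ 0 := by
    rw [pd_g, pd_q]
    have : 0 ≤ 2 * ε / (r x - c) ^ 3 :=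
      div_nonneg (by positivity) (pow_nonneg (sub_pos.2 (hrc x)).le _)
    have h3 : 0 ≤ (r x * deriv (deriv H) (r x)) * (2 * ε / (r x - c) ^ 3) * (pd i r x) ^ 2 := by
      positivity
    nlinarith
  simp only [Pi.zero_apply]
  linarith

/-- dissipation of convex entropies, Section 3: in the smooth
solution setting for the approximated TV Wasserstein gradient flow
`∂ₜρ + div(ρ ∇(div z - f'(ρ))) = 0` on the torus, with `f(s) = ε/(s-c)` (so that
`-f'(ρ) = ε/(ρ-c)²`), for every `C²` convex `H : (c,∞) → ℝ` the quantity
`t ↦ ∫ H(ρ(t,·))` is nonincreasing on `[0,T]`. -/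
theorem entropy_dissipation (d : ℕ) (hd : 1 ≤ d) (T ε c : ℝ)
    (hT : 0 < T) (hε : 0 ≤ ε) (hc : 0 ≤ c)
    (ρ : ℝ → EuclideanSpace ℝ (Fin d) → ℝ)
    (z : ℝ → EuclideanSpace ℝ (Fin d) → EuclideanSpace ℝ (Fin d))
    (hρsm : ContDiffOn ℝ (⊤ : ℕ∞) (fun p : ℝ × EuclideanSpace ℝ (Fin d) => ρ p.1 p.2)
      (Set.Icc 0 T ×ˢ Set.univ))
    (hzsm : ContDiffOn ℝ (⊤ : ℕ∞) (fun p : ℝ × EuclideanSpace ℝ (Fin d) => z p.1 p.2)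
      (Set.Icc 0 T ×ˢ Set.univ))
    (hρper : ∀ t ∈ Set.Icc (0 : ℝ) T, ZdPeriodic (ρ t))
    (hzper : ∀ t ∈ Set.Icc (0 : ℝ) T, ZdPeriodic (z t))
    (hρc : ∀ t ∈ Set.Icc (0 : ℝ) T, ∀ x, c < ρ t x)
    (hz1 : ∀ t ∈ Set.Icc (0 : ℝ) T, ∀ x, ‖z t x‖ ≤ 1)
    (hcomp : ∀ t ∈ Set.Icc (0 : ℝ) T,
      ∫ x in UnitCube d, ‖gradient (ρ t) x‖ ≤
        ∫ x in UnitCube d, ⟪z t x, gradient (ρ t) x⟫)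
    (hpde : ∀ t ∈ Set.Icc (0 : ℝ) T, ∀ x,
      deriv (fun s => ρ s x) t +
        diverg (fun y => ρ t y •
          gradient (fun w => diverg (z t) w + ε / (ρ t w - c) ^ 2) y) x = 0)
    (H : ℝ → ℝ) (hH : ContDiffOn ℝ 2 H (Set.Ioi c))
    (hHconv : ConvexOn ℝ (Set.Ioi c) H) :
    AntitoneOn (fun t => ∫ x in UnitCube d, H (ρ t x)) (Set.Icc 0 T) := by
  have hs : ∀ t ∈ Set.Icc (0 : ℝ) T, ContDiff ℝ ∞ (ρ t) := fun t ht =>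
    hρsm.comp_contDiff (contDiff_const.prodMk contDiff_id) fun x => ⟨ht, trivial⟩
  have hzs : ∀ t ∈ Set.Icc (0 : ℝ) T, ContDiff ℝ ∞ (z t) := fun t ht =>
    hzsm.comp_contDiff (contDiff_const.prodMk contDiff_id) fun x => ⟨ht, trivial⟩
  have hHc : ContinuousOn (fun p : ℝ × EuclideanSpace ℝ (Fin d) => H (ρ p.1 p.2))
      (Set.Icc 0 T ×ˢ Set.univ) :=
    hH.continuousOn.comp hρsm.continuousOn fun p hp => hρc p.1 hp.1 p.2
  have hHx : ∀ t ∈ Set.Icc (0 : ℝ) T, Continuous fun x => H (ρ t x) := fun t ht =>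
    hHc.comp_continuous (by fun_prop : Continuous fun x : EuclideanSpace ℝ (Fin d) => (t, x))
      fun x => ⟨ht, trivial⟩
  have hcube : ∀ᵐ x ∂(volume.restrict (UnitCube d)), x ∈ KCube d :=
    (ae_restrict_mem (measurableSet_cube d)).mono fun x hx => cube_subset d hx
  have hopen : IsOpen (Set.Ioo 0 T ×ˢ (Set.univ : Set (EuclideanSpace ℝ (Fin d)))) :=
    isOpen_Ioo.prod isOpen_univ
  have hH1 : ContDiffOn ℝ 1 (deriv H) (Set.Ioi c) :=
    hH.deriv_of_isOpen isOpen_Ioi (by norm_num)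
  have hHd : ∀ s ∈ Set.Ioi c, DifferentiableAt ℝ H s := fun s hs =>
    (hH.differentiableOn (by simp) s hs).differentiableAt (isOpen_Ioi.mem_nhds hs)
  set R : ℝ × EuclideanSpace ℝ (Fin d) → ℝ := fun p => ρ p.1 p.2 with hR
  have hRo : ContDiffOn ℝ ∞ R (Set.Ioo 0 T ×ˢ Set.univ) :=
    hρsm.mono (Set.prod_mono Set.Ioo_subset_Icc_self subset_rfl)
  have hRt : ContinuousOn (fun p => fderiv ℝ R p (1, 0)) (Set.Ioo 0 T ×ˢ Set.univ) :=
    (hRo.continuousOn_fderiv_of_isOpen hopen (by simp)).clm_apply continuousOn_const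
  have hF' : ContinuousOn (fun p => deriv H (R p) * fderiv ℝ R p (1, 0))
      (Set.Ioo 0 T ×ˢ Set.univ) :=
    (hH1.continuousOn.comp hRo.continuousOn
      fun p hp => hρc p.1 (Set.Ioo_subset_Icc_self hp.1) p.2).mul hRt
  have hdt : ∀ t ∈ Set.Ioo (0 : ℝ) T, ∀ x,
      HasDerivAt (fun s => ρ s x) (fderiv ℝ R (t, x) (1, 0)) t := by
    intro t ht x
    have h1 : DifferentiableAt ℝ R (t, x) :=
      (hRo.contDiffAt (hopen.mem_nhds ⟨ht, trivial⟩)).differentiableAt (by simp)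
    have h2 : HasDerivAt (fun s : ℝ => (s, x)) ((1 : ℝ), (0 : EuclideanSpace ℝ (Fin d))) t :=
      (hasDerivAt_id t).prodMk (hasDerivAt_const t x)
    exact h1.hasFDerivAt.comp_hasDerivAt t h2
  have hder : ∀ t ∈ Set.Ioo (0 : ℝ) T, HasDerivAt (fun t => ∫ x in UnitCube d, H (ρ t x))
      (∫ x in UnitCube d, deriv H (ρ t x) * fderiv ℝ R (t, x) (1, 0)) t := by
    intro t ht
    have hsub : Set.Icc (t / 2) ((t + T) / 2) ⊆ Set.Ioo 0 T := fun s hs =>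
      ⟨by linarith [hs.1, ht.1], by linarith [hs.2, ht.2]⟩
    obtain ⟨C, hC⟩ := (isCompact_Icc.prod (isCompact_KCube d)).exists_bound_of_continuousOn
      (hF'.mono (Set.prod_mono hsub (Set.subset_univ _)))
    have hnb : Set.Icc (t / 2) ((t + T) / 2) ∈ nhds t :=
      Icc_mem_nhds (by linarith [ht.1]) (by linarith [ht.2])
    refine (hasDerivAt_integral_of_dominated_loc_of_deriv_le (bound := fun _ => C)
      (F := fun t x => H (ρ t x))
      (F' := fun t x => deriv H (ρ t x) * fderiv ℝ R (t, x) (1, 0)) hnb ?_ ?_ ?_ ?_ ?_ ?_).2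
    · filter_upwards [hnb] with s hs
      exact (hHx s (Set.Ioo_subset_Icc_self (hsub hs))).aestronglyMeasurable
    · exact intOn_cube (hHx t (Set.Ioo_subset_Icc_self ht))
    · exact (hF'.comp_continuous
        (by fun_prop : Continuous fun x : EuclideanSpace ℝ (Fin d) => (t, x))
        fun x => ⟨ht, trivial⟩).aestronglyMeasurable
    · filter_upwards [hcube] with x hx s hs
      exact hC (s, x) ⟨hs, hx⟩
    · exact intOn_cube continuous_const
    · refine Filter.Eventually.of_forall fun x s hs => ?_
      exact (hHd _ (hρc s (Set.Ioo_subset_Icc_self (hsub hs)) x)).hasDerivAt.comp s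
        (hdt s (hsub hs) x)
  apply antitoneOn_of_deriv_nonpos (convex_Icc 0 T)
  · obtain ⟨C, hC⟩ := (isCompact_Icc.prod (isCompact_KCube d)).exists_bound_of_continuousOn
      (hHc.mono (Set.prod_mono subset_rfl (Set.subset_univ _)))
    refine continuousOn_of_dominated (bound := fun _ => C)
      (fun t ht => (hHx t ht).aestronglyMeasurable) ?_ (intOn_cube continuous_const) ?_
    · intro t ht
      filter_upwards [hcube] with x hx
      exact hC (t, x) ⟨ht, hx⟩
    · refine Filter.Eventually.of_forall fun x => ?_
      exact hHc.comp (by fun_prop : Continuous fun t : ℝ => (t, x)).continuousOn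
        fun t ht => ⟨ht, trivial⟩
  · rw [interior_Icc]
    exact fun t ht => (hder t ht).differentiableAt.differentiableWithinAt
  · rw [interior_Icc]
    intro t ht
    have ht' := Set.Ioo_subset_Icc_self ht
    rw [(hder t ht).deriv]
    have key := slice hε hc (hs t ht') (hzs t ht') (hρper t ht') (hzper t ht') (hρc t ht')
      (hz1 t ht') (hcomp t ht') hH hHconv
    have e : ∀ x, deriv H (ρ t x) * fderiv ℝ R (t, x) (1, 0) =
        - (deriv H (ρ t x) * diverg (fun y => ρ t y •
          gradient (fun w => diverg (z t) w + ε / (ρ t w - c) ^ 2) y) x) := by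
      intro x
      have h := hpde t ht' x
      rw [(hdt t ht x).deriv] at h
      rw [eq_neg_of_add_eq_zero_left h]; ring
    simp only [e]
    rw [integral_neg]
    linarith

end
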